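/- (Unboundedness of the second-order Duhamel iterate, wave component.) Fix 0 < T ≤ 1 and k,ℓ ∈ ℝ. There exist constants c > 0 and N₀ ≥ 1 (independent of N) such that for every N ≥ N₀ there exists a nonzero u_N ∈ H^k(ℝ²) with sup_{|t|≤T} ‖ ∫₀ᵗ e^{−i(t−t')⟨∇⟩} (Δ/⟨∇⟩)( e^{it'Δ}u_N · conj(e^{it'Δ}u_N) ) dt' ‖_{H^ℓ} ≥ c N^{ℓ−2k+1/2} ‖u_N‖²_{H^k}. -/

import Mathlib

noncomputable section

open MeasureTheory Real
open scoped FourierTransform ENNReal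

/-- The spatial domain ℝ². -/
abbrev Plane : Type := EuclideanSpace ℝ (Fin 2)

/-- The Japanese bracket ⟨x⟩ = (1+x²)^{1/2}. -/
def jap (r : ℝ) : ℝ := Real.sqrt (1 + r ^ 2)

/-- The Sobolev norm ‖φ‖_{H^s} = ‖⟨ξ⟩^s 𝔉φ‖_{L²(ℝ²)}. -/
def Hnorm (s : ℝ) (φ : Plane → ℂ) : ℝ≥0∞ :=
  eLpNorm (fun ξ => ((jap ‖ξ‖ ^ s : ℝ) : ℂ) * 𝓕 φ ξ) 2 volume

/-- The Schrödinger group e^{itΔ}, the Fourier multiplier with symbol e^{−it|ξ|²}. -/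
def schrG (t : ℝ) (φ : Plane → ℂ) : Plane → ℂ :=
  𝓕⁻ fun ξ => Complex.exp (-Complex.I * (t : ℂ) * ((‖ξ‖ ^ 2 : ℝ) : ℂ)) * 𝓕 φ ξ

/-- The half-wave group e^{−it⟨∇⟩}, the Fourier multiplier with symbol e^{−it⟨ξ⟩}. -/
def waveG (t : ℝ) (φ : Plane → ℂ) : Plane → ℂ :=
  𝓕⁻ fun ξ => Complex.exp (-Complex.I * (t : ℂ) * ((jap ‖ξ‖ : ℝ) : ℂ)) * 𝓕 φ ξ

/-- The operator Δ/⟨∇⟩: the spatial Fourier multiplier with symbol −|ξ|²⟨ξ⟩^{−1}. -/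
def DeltaOp (φ : Plane → ℂ) : Plane → ℂ :=
  𝓕⁻ fun ξ => ((-‖ξ‖ ^ 2 / jap ‖ξ‖ : ℝ) : ℂ) * 𝓕 φ ξ

section Iterate

open scoped ContDiff SchwartzMap
open Set Function

local notation "conj" => starRingEnd ℂ

section Analysis

variable {V P : Type*} [NormedAddCommGroup V] [InnerProductSpace ℝ V] [FiniteDimensional ℝ V]
  [MeasurableSpace V] [BorelSpace V] [NormedAddCommGroup P] [NormedSpace ℝ P]

/-- Fourier inversion for test functions. -/
lemma fourier_fourierInv_of_hasCompactSupport {H : V → ℂ} (hc : HasCompactSupport H)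
    (hs : ContDiff ℝ ∞ H) : 𝓕 (𝓕⁻ H) = H := by
  have h : ((𝓕 (𝓕⁻ (hc.toSchwartzMap hs)) : 𝓢(V, ℂ)) : V → ℂ) = H := by
    rw [FourierTransform.fourier_fourierInv_eq]; rfl
  rw [SchwartzMap.fourier_coe, SchwartzMap.fourierInv_coe] at h
  exact h

/-- The Fourier transform of `|𝓕⁻ Q|²` is the autocorrelation of `Q`. -/
lemma fourier_mul_conj_fourierInv {Q : V → ℂ} (hc : HasCompactSupport Q)
    (hs : ContDiff ℝ ∞ Q) (ξ : V) :
    𝓕 (fun y => 𝓕⁻ Q y * conj (𝓕⁻ Q y)) ξ = ∫ η, Q (ξ + η) * conj (Q η) := by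
  have hc₁ : HasCompactSupport fun η => conj (Q η) := hc.comp_left (map_zero _)
  have hs₁ : ContDiff ℝ ∞ fun η => conj (Q η) := Complex.conjCLE.contDiff.comp hs
  have hc₂ : HasCompactSupport fun η => Q (ξ + η) := hc.comp_homeomorph (Homeomorph.addLeft ξ)
  have hs₂ : ContDiff ℝ ∞ fun η => Q (ξ + η) := hs.comp (contDiff_const.add contDiff_id)
  have h := SchwartzMap.integral_fourier_mul_eq (hc₁.toSchwartzMap hs₁)
    (𝓕⁻ (hc₂.toSchwartzMap hs₂))
  rw [FourierTransform.fourier_fourierInv_eq, SchwartzMap.fourier_coe,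
    SchwartzMap.fourierInv_coe] at h
  have e₁ : ∀ y, 𝓕 (⇑(hc₁.toSchwartzMap hs₁)) y = conj (𝓕⁻ Q y) := by
    intro y
    rw [fourier_eq', fourierInv_eq', ← integral_conj]
    refine integral_congr_ae (.of_forall fun v => ?_)
    simp [← Complex.exp_conj, Complex.conj_ofNat]
  have e₂ : ∀ y, 𝓕⁻ (⇑(hc₂.toSchwartzMap hs₂)) y =
      Complex.exp (↑(-2 * π * inner ℝ y ξ) * Complex.I) * 𝓕⁻ Q y := by
    intro y
    rw [fourierInv_eq', fourierInv_eq', ← integral_const_mul]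
    conv_rhs => rw [← integral_add_left_eq_self _ ξ]
    refine integral_congr_ae (.of_forall fun v => ?_)
    simp only [smul_eq_mul]
    rw [← mul_assoc, ← Complex.exp_add]
    congr 2
    rw [inner_add_left, real_inner_comm ξ y]
    push_cast
    ring
  rw [fourier_eq']
  simp only [e₁, e₂] at h
  calc _ = ∫ y, conj (𝓕⁻ Q y) *
        (Complex.exp (↑(-2 * π * inner ℝ y ξ) * Complex.I) * 𝓕⁻ Q y) := by
        congr 1; ext y; rw [smul_eq_mul]; ring
    _ = _ := by
        rw [h]
        congr 1; ext y
        simp [mul_comm]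

/-- Integrating out a compactly supported variable preserves smoothness. -/
lemma ContDiff.integral_smul_of_isCompact {f : V → ℝ} (hf : LocallyIntegrable f)
    {K : P → V → ℂ} {k : Set V} (hk : IsCompact k) (h0 : ∀ p, ∀ v ∉ k, K p v = 0)
    (hK : ContDiff ℝ ∞ ↿K) : ContDiff ℝ ∞ fun p => ∫ v, f v • K p v := by
  have h := contDiffOn_convolution_right_with_param (𝕜 := ℝ) (n := ⊤) (μ := (volume : Measure V))
    (ContinuousLinearMap.lsmul ℝ ℝ : ℝ →L[ℝ] ℂ →L[ℝ] ℂ) (g := fun p v => K p (-v))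
    (s := univ) (k := -k) isOpen_univ hk.neg
    (fun p v _ hv => h0 p _ (by simpa using hv)) hf
    (ContDiff.contDiffOn (hK.comp (contDiff_fst.prodMk contDiff_snd.neg)))
  rw [univ_prod_univ, contDiffOn_univ] at h
  have h' := h.comp (contDiff_id.prodMk contDiff_const : ContDiff ℝ ∞ fun p : P => (p, (0 : V)))
  convert! h' using 2 with p
  simp [convolution]

/-- Interval integrals of smooth functions depend smoothly on parameters. -/
lemma ContDiff.intervalIntegral_param {K : P → ℝ → ℂ} (hK : ContDiff ℝ ∞ ↿K) {a : ℝ}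
    (ha : 0 ≤ a) : ContDiff ℝ ∞ fun p => ∫ s in (0 : ℝ)..a, K p s := by
  let χ : ContDiffBump (0 : ℝ) := ⟨a + 1, a + 2, by linarith, by linarith⟩
  have h := ContDiff.integral_smul_of_isCompact (V := ℝ) (f := (Ioc 0 a).indicator 1)
    (K := fun p s => (χ s : ℂ) * K p s) (k := tsupport χ)
    (((integrable_indicator_iff measurableSet_Ioc).2
      (integrableOn_const (by simp))).locallyIntegrable) χ.hasCompactSupport
    (fun p s hs => by simp [image_eq_zero_of_notMem_tsupport hs])
    (by
      refine ContDiff.mul ?_ hK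
      exact Complex.ofRealCLM.contDiff.comp (χ.contDiff.comp contDiff_snd))
  convert! h using 2 with p
  rw [intervalIntegral.integral_of_le ha, ← integral_indicator measurableSet_Ioc]
  congr 1; ext s
  by_cases hs : s ∈ Ioc 0 a
  · have : χ s = 1 := χ.one_of_mem_closedBall (by
      simp only [Metric.mem_closedBall, dist_zero_right, Real.norm_eq_abs]
      rw [abs_of_pos hs.1]; change s ≤ a + 1; linarith [hs.2])
    simp [hs, this]
  · simp [hs]

end Analysis

section Duhamel

open scoped Pointwise

/-- The autocorrelation at time `t` of the free Schrödinger evolution of `G`, in frequency. -/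
def schrAutocorr (G : Plane → ℂ) (t : ℝ) (ξ : Plane) : ℂ :=
  ∫ η, Complex.exp (-Complex.I * (t : ℂ) * ((‖ξ + η‖ ^ 2 : ℝ) : ℂ)) * G (ξ + η) *
    conj (Complex.exp (-Complex.I * (t : ℂ) * ((‖η‖ ^ 2 : ℝ) : ℂ)) * G η)

lemma jap_pos (r : ℝ) : 0 < jap r := Real.sqrt_pos.2 (by positivity)

lemma contDiff_jap_norm : ContDiff ℝ ∞ fun ξ : Plane => jap ‖ξ‖ :=
  (contDiff_const.add (contDiff_norm_sq ℝ)).sqrt fun _ => by positivity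

lemma contDiff_deltaSymbol : ContDiff ℝ ∞ fun ξ : Plane => ((-‖ξ‖ ^ 2 / jap ‖ξ‖ : ℝ) : ℂ) :=
  Complex.ofRealCLM.contDiff.comp
    ((contDiff_norm_sq ℝ).neg.div contDiff_jap_norm fun _ => (jap_pos _).ne')

variable {G : Plane → ℂ}

lemma contDiff_schrAutocorr_integrand (hs : ContDiff ℝ ∞ G) : ContDiff ℝ ∞ fun q : (Plane × ℝ) × Plane =>
    Complex.exp (-Complex.I * (q.1.2 : ℂ) * ((‖q.1.1 + q.2‖ ^ 2 : ℝ) : ℂ)) * G (q.1.1 + q.2) *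
      conj (Complex.exp (-Complex.I * (q.1.2 : ℂ) * ((‖q.2‖ ^ 2 : ℝ) : ℂ)) * G q.2) := by
  have hsum : ContDiff ℝ ∞ fun q : (Plane × ℝ) × Plane => q.1.1 + q.2 :=
    contDiff_fst.fst.add contDiff_snd
  have hexp : ∀ {f : (Plane × ℝ) × Plane → Plane}, ContDiff ℝ ∞ f → ContDiff ℝ ∞
      fun q : (Plane × ℝ) × Plane =>
        Complex.exp (-Complex.I * (q.1.2 : ℂ) * ((‖f q‖ ^ 2 : ℝ) : ℂ)) := fun hf =>
    ((contDiff_const.mul (Complex.ofRealCLM.contDiff.comp contDiff_fst.snd)).mul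
      (Complex.ofRealCLM.contDiff.comp (hf.norm_sq ℝ))).cexp
  exact ((hexp hsum).mul (hs.comp hsum)).mul
    (Complex.conjCLE.contDiff.comp ((hexp contDiff_snd).mul (hs.comp contDiff_snd)))

lemma contDiff_schrAutocorr (hc : HasCompactSupport G) (hs : ContDiff ℝ ∞ G) :
    ContDiff ℝ ∞ fun q : Plane × ℝ => schrAutocorr G q.2 q.1 := by
  have h := ContDiff.integral_smul_of_isCompact (P := Plane × ℝ) (V := Plane) (f := fun _ => 1)
    (k := tsupport G) (locallyIntegrable_const 1) hc (K := fun q η =>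
      Complex.exp (-Complex.I * (q.2 : ℂ) * ((‖q.1 + η‖ ^ 2 : ℝ) : ℂ)) * G (q.1 + η) *
        conj (Complex.exp (-Complex.I * (q.2 : ℂ) * ((‖η‖ ^ 2 : ℝ) : ℂ)) * G η))
    (fun q η hη => by simp [image_eq_zero_of_notMem_tsupport hη])
    (contDiff_schrAutocorr_integrand hs)
  simp only [one_smul] at h
  exact h

lemma schrAutocorr_eq_zero {t : ℝ} {ξ : Plane} (hξ : ξ ∉ tsupport G - tsupport G) :
    schrAutocorr G t ξ = 0 := by
  refine (integral_congr_ae (.of_forall fun η => ?_)).trans (integral_zero _ _)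
  by_cases h₁ : η ∈ tsupport G
  · have h₂ : ξ + η ∉ tsupport G := fun h₂ => hξ ⟨_, h₂, _, h₁, by simp⟩
    simp [image_eq_zero_of_notMem_tsupport h₂]
  · simp [image_eq_zero_of_notMem_tsupport h₁]

/-- The Duhamel integrand on the Fourier side. -/
def duhamelSymbol (G : Plane → ℂ) (a s : ℝ) (ξ : Plane) : ℂ :=
  Complex.exp (-Complex.I * ((a - s : ℝ) : ℂ) * ((jap ‖ξ‖ : ℝ) : ℂ)) *
    (((-‖ξ‖ ^ 2 / jap ‖ξ‖ : ℝ) : ℂ) * schrAutocorr G s ξ)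

lemma contDiff_duhamelSymbol (hc : HasCompactSupport G) (hs : ContDiff ℝ ∞ G) (a : ℝ) :
    ContDiff ℝ ∞ fun q : Plane × ℝ => duhamelSymbol G a q.2 q.1 := by
  refine ContDiff.mul ?_ ((contDiff_deltaSymbol.comp contDiff_fst).mul
    (contDiff_schrAutocorr hc hs))
  exact ((contDiff_const.mul (Complex.ofRealCLM.contDiff.comp
    (contDiff_const.sub contDiff_snd))).mul
    (Complex.ofRealCLM.contDiff.comp (contDiff_jap_norm.comp contDiff_fst))).cexp

lemma duhamelSymbol_eq_zero {a s : ℝ} {ξ : Plane} (hξ : ξ ∉ tsupport G - tsupport G) :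
    duhamelSymbol G a s ξ = 0 := by
  simp [duhamelSymbol, schrAutocorr_eq_zero hξ]

lemma isCompact_tsupport_sub (hc : HasCompactSupport G) : IsCompact (tsupport G - tsupport G) := by
  rw [sub_eq_add_neg]
  exact IsCompact.add hc (IsCompact.neg hc)

lemma waveG_deltaOp_schrG (hc : HasCompactSupport G) (hs : ContDiff ℝ ∞ G) (a s : ℝ) :
    waveG (a - s) (DeltaOp fun y => schrG s (𝓕⁻ G) y * conj (schrG s (𝓕⁻ G) y)) =
      𝓕⁻ (duhamelSymbol G a s) := by
  have hslice : ∀ {F : Plane × ℝ → ℂ}, ContDiff ℝ ∞ F → ContDiff ℝ ∞ fun ξ => F (ξ, s) :=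
    fun hF => hF.comp (contDiff_id.prodMk contDiff_const)
  have hQc : HasCompactSupport fun ξ : Plane =>
      Complex.exp (-Complex.I * (s : ℂ) * ((‖ξ‖ ^ 2 : ℝ) : ℂ)) * G ξ := hc.mul_left
  have hQs : ContDiff ℝ ∞ fun ξ : Plane =>
      Complex.exp (-Complex.I * (s : ℂ) * ((‖ξ‖ ^ 2 : ℝ) : ℂ)) * G ξ :=
    (contDiff_const.mul (Complex.ofRealCLM.contDiff.comp (contDiff_norm_sq ℝ))).cexp.mul hs
  have h₁ : 𝓕 (fun y => schrG s (𝓕⁻ G) y * conj (schrG s (𝓕⁻ G) y)) = schrAutocorr G s := by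
    ext ξ
    simp only [schrG, fourier_fourierInv_of_hasCompactSupport hc hs]
    rw [fourier_mul_conj_fourierInv hQc hQs]
    rfl
  have h₂ : HasCompactSupport fun ξ => ((-‖ξ‖ ^ 2 / jap ‖ξ‖ : ℝ) : ℂ) * schrAutocorr G s ξ :=
    .intro (isCompact_tsupport_sub hc) fun ξ hξ => by rw [schrAutocorr_eq_zero hξ, mul_zero]
  have h₃ : ContDiff ℝ ∞ fun ξ => ((-‖ξ‖ ^ 2 / jap ‖ξ‖ : ℝ) : ℂ) * schrAutocorr G s ξ :=
    contDiff_deltaSymbol.mul (hslice (contDiff_schrAutocorr hc hs))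
  rw [waveG, DeltaOp, h₁, fourier_fourierInv_of_hasCompactSupport h₂ h₃]
  rfl

/-- The Fourier transform of the second Duhamel iterate. -/
lemma fourier_duhamel (hc : HasCompactSupport G) (hs : ContDiff ℝ ∞ G) {a : ℝ} (ha : 0 ≤ a) :
    𝓕 (fun x => ∫ s in (0 : ℝ)..a, waveG (a - s)
      (DeltaOp fun y => schrG s (𝓕⁻ G) y * conj (schrG s (𝓕⁻ G) y)) x) =
      fun ξ => ∫ s in (0 : ℝ)..a, duhamelSymbol G a s ξ := by
  have hS := contDiff_duhamelSymbol hc hs a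
  have hM : ContDiff ℝ ∞ fun ξ => ∫ s in (0 : ℝ)..a, duhamelSymbol G a s ξ :=
    ContDiff.intervalIntegral_param (K := fun ξ s => duhamelSymbol G a s ξ) hS ha
  have hMc : HasCompactSupport fun ξ => ∫ s in (0 : ℝ)..a, duhamelSymbol G a s ξ :=
    .intro (isCompact_tsupport_sub hc) fun ξ hξ => by simp [duhamelSymbol_eq_zero hξ]
  rw [← fourier_fourierInv_of_hasCompactSupport hMc hM]
  congr 1; ext x
  simp only [waveG_deltaOp_schrG hc hs, fourierInv_eq']
  simp_rw [← intervalIntegral.integral_smul]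
  refine intervalIntegral_integral_swap ?_
  have hcont : Continuous fun q : ℝ × Plane =>
      Complex.exp (↑(2 * π * inner ℝ q.2 x) * Complex.I) • duhamelSymbol G a q.1 q.2 :=
    Continuous.smul (M := ℂ) (f := fun q : ℝ × Plane =>
      Complex.exp (↑(2 * π * inner ℝ q.2 x) * Complex.I)) (by fun_prop)
      (hS.continuous.comp (continuous_snd.prodMk continuous_fst))
  have hK : IsCompact (Icc (0 : ℝ) a ×ˢ (tsupport G - tsupport G)) :=
    isCompact_Icc.prod (isCompact_tsupport_sub hc)
  rw [uIoc_of_le ha, ← Measure.restrict_univ (μ := (volume : Measure Plane)),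
    Measure.prod_restrict]
  refine (hcont.continuousOn.integrableOn_compact hK).of_forall_sdiff_eq_zero
    (measurableSet_Ioc.prod .univ) fun q hq => ?_
  have : q.2 ∉ tsupport G - tsupport G := fun h => hq.2 ⟨Ioc_subset_Icc_self hq.1.1, h⟩
  simp [duhamelSymbol_eq_zero this]

end Duhamel

section LowerBound

lemma rpow_le_of_mem_Icc {N x : ℝ} (hN : 0 < N) (h₁ : N / 4 ≤ x) (h₂ : x ≤ 4 * N) (k : ℝ) :
    x ^ k ≤ 4 ^ |k| * N ^ k := by
  have hx : 0 < x := by linarith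
  have hq : x ^ k = (x / N) ^ k * N ^ k := by
    rw [← mul_rpow (by positivity) hN.le, div_mul_cancel₀ _ hN.ne']
  rw [hq]
  gcongr
  rcases le_total 0 k with hk | hk
  · rw [abs_of_nonneg hk]
    exact rpow_le_rpow (by positivity) ((div_le_iff₀ hN).2 h₂) hk
  · rw [abs_of_nonpos hk, rpow_neg (by norm_num), ← inv_rpow (by norm_num)]
    refine rpow_le_rpow_of_nonpos (by norm_num) ?_ hk
    rw [le_div_iff₀ hN]; linarith

lemma le_rpow_of_mem_Icc {N x : ℝ} (hN : 0 < N) (h₁ : N / 4 ≤ x) (h₂ : x ≤ 4 * N) (k : ℝ) :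
    (4 ^ |k|)⁻¹ * N ^ k ≤ x ^ k := by
  have hx : 0 < x := by linarith
  have h := rpow_le_of_mem_Icc hN h₁ h₂ (-k)
  rw [rpow_neg hx.le, rpow_neg hN.le, abs_neg] at h
  rw [← inv_inv (x ^ k)]
  refine (le_inv_comm₀ (by positivity) (by positivity)).1 (h.trans_eq ?_)
  rw [mul_inv, inv_inv]

lemma norm_sq_plane (ξ : Plane) : ‖ξ‖ ^ 2 = ξ 0 ^ 2 + ξ 1 ^ 2 := by
  rw [EuclideanSpace.real_norm_sq_eq, Fin.sum_univ_two]

lemma jap_mem_Icc {N : ℝ} (hN : 10 ≤ N) {ξ : Plane} (h₀ : N / 4 ≤ |ξ 0|) (h₀' : |ξ 0| ≤ 2 * N)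
    (h₁ : |ξ 1| ≤ 1) : N / 4 ≤ jap ‖ξ‖ ∧ jap ‖ξ‖ ≤ 4 * N := by
  have e₀ := sq_abs (ξ 0)
  have e₁ := sq_abs (ξ 1)
  rw [jap, norm_sq_plane]
  constructor
  · apply Real.le_sqrt_of_sq_le
    nlinarith [sq_nonneg (ξ 1)]
  · apply Real.sqrt_le_iff.2 ⟨by linarith, ?_⟩
    nlinarith [abs_nonneg (ξ 0), abs_nonneg (ξ 1)]

lemma le_norm_sq_div_jap {N : ℝ} (hN : 10 ≤ N) {ξ : Plane} (h₀ : N / 2 ≤ |ξ 0|) :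
    N / 4 ≤ ‖ξ‖ ^ 2 / jap ‖ξ‖ := by
  have e₀ := sq_abs (ξ 0)
  have hn : N / 2 ≤ ‖ξ‖ := by
    have : (N / 2) ^ 2 ≤ ‖ξ‖ ^ 2 := by
      rw [norm_sq_plane]; nlinarith [sq_nonneg (ξ 1)]
    exact le_of_sq_le_sq this (norm_nonneg _)
  have hj : jap ‖ξ‖ ≤ 2 * ‖ξ‖ := by
    apply Real.sqrt_le_iff.2 ⟨by positivity, ?_⟩
    nlinarith
  rw [le_div_iff₀ (jap_pos _)]
  nlinarith

/-- The resonance function stays bounded on the high-high interaction set. -/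
lemma abs_resonance_le_one {N p q y z : ℝ} (hN : 10 ≤ N)
    (h₁ : |p + y - (N / 2 + 1 / 2)| ≤ 1 / 16 / N) (h₂ : |y - (-N / 2 + 1 / 2)| ≤ 1 / 16 / N)
    (h₃ : |q + z| ≤ 1 / 16) (h₄ : |z| ≤ 1 / 16) :
    |√(1 + (p ^ 2 + q ^ 2)) - (((p + y) ^ 2 + (q + z) ^ 2) - (y ^ 2 + z ^ 2))| ≤ 1 := by
  have hN0 : 0 < N := by linarith
  obtain ⟨μ, hμ⟩ : ∃ μ, μ = 1 / 16 / N := ⟨_, rfl⟩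
  have hμN : μ * N = 1 / 16 := by rw [hμ]; field_simp
  have hμ0 : 0 < μ := by rw [hμ]; positivity
  rw [← hμ] at h₁ h₂
  rw [abs_le] at h₁ h₂ h₃ h₄
  have hμ1 : μ ≤ 1 / 160 := by nlinarith
  obtain ⟨γ, hγ⟩ : ∃ γ, γ = p + 2 * y - 1 := ⟨_, rfl⟩
  have hγ1 : |γ| ≤ 2 * μ := by rw [abs_le]; constructor <;> linarith
  have hp1 : N - 1 / 80 ≤ p := by linarith
  have hp2 : p ≤ N + 1 / 80 := by linarith
  have hpγ : |p * γ| ≤ 1 / 4 := by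
    rw [abs_mul, abs_of_pos (by linarith : 0 < p)]
    nlinarith [abs_nonneg γ]
  have hs1 : p ≤ √(1 + (p ^ 2 + q ^ 2)) := Real.le_sqrt_of_sq_le (by nlinarith)
  have hs2 : √(1 + (p ^ 2 + q ^ 2)) ≤ p + 1 / 4 :=
    Real.sqrt_le_iff.2 ⟨by linarith, by nlinarith⟩
  have hz1 : z ^ 2 ≤ 1 / 256 := by nlinarith
  have hz2 : (q + z) ^ 2 ≤ 1 / 256 := by nlinarith
  have key : ((p + y) ^ 2 + (q + z) ^ 2) - (y ^ 2 + z ^ 2) =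
      p + p * γ + (q + z) ^ 2 - z ^ 2 := by rw [hγ]; ring
  rw [key]
  rw [abs_le] at hpγ ⊢
  constructor <;> nlinarith [sq_nonneg z, sq_nonneg (q + z)]

/-- The thin box of radii `r / N` and `r` centred at `(c, 0)`. -/
def thinBox (N c r : ℝ) : Set Plane := {ξ | |ξ 0 - c| ≤ r / N ∧ |ξ 1| ≤ r}

lemma isClosed_thinBox (N c r : ℝ) : IsClosed (thinBox N c r) := by
  have h₀ : IsClosed {ξ : Plane | |ξ 0 - c| ≤ r / N} :=
    isClosed_le (by fun_prop) continuous_const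
  have h₁ : IsClosed {ξ : Plane | |ξ 1| ≤ r} := isClosed_le (by fun_prop) continuous_const
  exact h₀.inter h₁

lemma volume_thinBox {N r : ℝ} (c : ℝ) (hN : 0 < N) (hr : 0 ≤ r) :
    volume (thinBox N c r) = ENNReal.ofReal (4 * r ^ 2 / N) := by
  have h : thinBox N c r = (MeasurableEquiv.toLp 2 (Fin 2 → ℝ)).symm ⁻¹'
      (univ.pi ![Icc (c - r / N) (c + r / N), Icc (-r) r]) := by
    ext ξ
    simp only [thinBox, mem_ofPred_eq, abs_le, mem_preimage, mem_univ_pi, Fin.forall_fin_two,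
      Matrix.cons_val_zero, Matrix.cons_val_one, mem_Icc]
    refine and_congr_left fun _ => and_congr ?_ ?_
    · exact ⟨fun h => by simpa using by linarith, fun h => by
        have : c - r / N ≤ ξ 0 := h
        linarith⟩
    · exact ⟨fun h => by simpa using by linarith, fun h => by
        have : ξ 0 ≤ c + r / N := h
        linarith⟩
  rw [h,
    (EuclideanSpace.volume_preserving_symm_measurableEquiv_toLp (Fin 2)).measure_preimage_equiv, volume_pi_pi, Fin.prod_univ_two]
  simp only [Matrix.cons_val_zero, Matrix.cons_val_one, Real.volume_Icc]
  rw [← ENNReal.ofReal_mul (by ring_nf; positivity)]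
  congr 1; ring

lemma isCompact_thinBox (N c r : ℝ) : IsCompact (thinBox N c r) := by
  refine Metric.isCompact_of_isClosed_isBounded (isClosed_thinBox N c r) ?_
  refine (Metric.isBounded_closedBall (x := (0 : Plane)) (r := |c| + |r / N| + |r|)).subset ?_
  intro ξ hξ
  rw [mem_closedBall_zero_iff]
  have h₀ : |ξ 0| ≤ |c| + |r / N| := by
    have := abs_sub_abs_le_abs_sub (ξ 0) c
    linarith [hξ.1, le_abs_self (r / N)]
  have h₁ : |ξ 1| ≤ |r| := hξ.2.trans (le_abs_self r)
  refine le_of_sq_le_sq ?_ (by positivity)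
  rw [norm_sq_plane, ← sq_abs (ξ 0), ← sq_abs (ξ 1)]
  nlinarith [abs_nonneg (ξ 0), abs_nonneg (ξ 1)]

end LowerBound

section LowerBound

variable {g : Plane → ℝ}

lemma integrable_autocorr (hc : HasCompactSupport g) (hs : ContDiff ℝ ∞ g) (ξ : Plane) : Integrable fun η => g (ξ + η) * g η :=
  ((hs.continuous.comp (by fun_prop)).mul hs.continuous).integrable_of_hasCompactSupport
    hc.mul_left

/-- In the absence of oscillation, the autocorrelation at time `s` is comparable to the one at
time `0`. -/
lemma half_autocorr_le_re (hc : HasCompactSupport g) (hs : ContDiff ℝ ∞ g) {s : ℝ} {ξ : Plane} (hg : ∀ η, 0 ≤ g η)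
    (hs₀ : 0 ≤ s) (hs₁ : s ≤ 1)
    (hΩ : ∀ η, g (ξ + η) * g η ≠ 0 → |jap ‖ξ‖ - (‖ξ + η‖ ^ 2 - ‖η‖ ^ 2)| ≤ 1) :
    (∫ η, g (ξ + η) * g η) / 2 ≤
      (Complex.exp (Complex.I * (s : ℂ) * ((jap ‖ξ‖ : ℝ) : ℂ)) *
        schrAutocorr (fun η => (g η : ℂ)) s ξ).re := by
  have hpt : ∀ η, Complex.exp (Complex.I * (s : ℂ) * ((jap ‖ξ‖ : ℝ) : ℂ)) *
      (Complex.exp (-Complex.I * (s : ℂ) * ((‖ξ + η‖ ^ 2 : ℝ) : ℂ)) * g (ξ + η) *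
        conj (Complex.exp (-Complex.I * (s : ℂ) * ((‖η‖ ^ 2 : ℝ) : ℂ)) * g η)) =
      ((g (ξ + η) * g η : ℝ) : ℂ) *
        Complex.exp (((s * (jap ‖ξ‖ - (‖ξ + η‖ ^ 2 - ‖η‖ ^ 2)) : ℝ) : ℂ) * Complex.I) := by
    intro η
    have : ((s * (jap ‖ξ‖ - (‖ξ + η‖ ^ 2 - ‖η‖ ^ 2)) : ℝ) : ℂ) * Complex.I =
        Complex.I * (s : ℂ) * ((jap ‖ξ‖ : ℝ) : ℂ) +
          (-Complex.I * (s : ℂ) * ((‖ξ + η‖ ^ 2 : ℝ) : ℂ) +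
            -(-Complex.I * (s : ℂ) * ((‖η‖ ^ 2 : ℝ) : ℂ))) := by
      push_cast; ring
    rw [this, Complex.exp_add, Complex.exp_add, map_mul, ← Complex.exp_conj]
    simp only [map_mul, map_neg, Complex.conj_I, Complex.conj_ofReal]
    push_cast
    ring_nf
  have hi := integrable_autocorr hc hs ξ
  rw [schrAutocorr, ← integral_const_mul]
  simp_rw [hpt]
  have hint : Integrable fun η => ((g (ξ + η) * g η : ℝ) : ℂ) *
      Complex.exp (((s * (jap ‖ξ‖ - (‖ξ + η‖ ^ 2 - ‖η‖ ^ 2)) : ℝ) : ℂ) * Complex.I) := by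
    refine hi.ofReal.mul_bdd (c := 1) (Continuous.aestronglyMeasurable (by fun_prop))
      (.of_forall fun η => ?_)
    exact (Complex.norm_exp_ofReal_mul_I _).le
  rw [← RCLike.re_eq_complex_re, ← integral_re hint, ← integral_div]
  refine integral_mono (hi.div_const 2) hint.re fun η => ?_
  simp only [RCLike.re_eq_complex_re, Complex.re_ofReal_mul, Complex.exp_ofReal_mul_I_re]
  by_cases h0 : g (ξ + η) * g η = 0
  · simp [h0]
  · have hnn : 0 ≤ g (ξ + η) * g η := mul_nonneg (hg _) (hg _)
    have hθ : |s * (jap ‖ξ‖ - (‖ξ + η‖ ^ 2 - ‖η‖ ^ 2))| ≤ 1 := by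
      rw [abs_mul, abs_of_nonneg hs₀]
      exact mul_le_one₀ hs₁ (abs_nonneg _) (hΩ η h0)
    have h2 := one_sub_sq_div_two_le_cos (x := s * (jap ‖ξ‖ - (‖ξ + η‖ ^ 2 - ‖η‖ ^ 2)))
    have h3 := (sq_le_one_iff_abs_le_one _).2 hθ
    nlinarith

/-- Lower bound for the Fourier transform of the Duhamel iterate at a resonant frequency. -/
lemma le_norm_integral_duhamelSymbol (hc : HasCompactSupport g) (hs : ContDiff ℝ ∞ g) {a : ℝ} {ξ : Plane} (hg : ∀ η, 0 ≤ g η)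
    (ha₀ : 0 ≤ a) (ha₁ : a ≤ 1)
    (hΩ : ∀ η, g (ξ + η) * g η ≠ 0 → |jap ‖ξ‖ - (‖ξ + η‖ ^ 2 - ‖η‖ ^ 2)| ≤ 1) :
    ‖ξ‖ ^ 2 / jap ‖ξ‖ * (a * ((∫ η, g (ξ + η) * g η) / 2)) ≤
      ‖∫ s in (0 : ℝ)..a, duhamelSymbol (fun η => (g η : ℂ)) a s ξ‖ := by
  have hcG : HasCompactSupport fun η => (g η : ℂ) := hc.comp_left Complex.ofReal_zero
  have hsG : ContDiff ℝ ∞ fun η => (g η : ℂ) := Complex.ofRealCLM.contDiff.comp hs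
  let w : ℝ → ℂ := fun s => Complex.exp (Complex.I * (s : ℂ) * ((jap ‖ξ‖ : ℝ) : ℂ)) *
    schrAutocorr (fun η => (g η : ℂ)) s ξ
  have hw : Continuous w := by
    have h₁ : Continuous fun s : ℝ =>
        Complex.exp (Complex.I * (s : ℂ) * ((jap ‖ξ‖ : ℝ) : ℂ)) := by fun_prop
    have h₂ : Continuous fun s : ℝ => ((ξ, s) : Plane × ℝ) := by fun_prop
    have h₃ := (contDiff_schrAutocorr hcG hsG).continuous.comp h₂
    exact h₁.mul h₃
  have hfac : ∀ s, duhamelSymbol (fun η => (g η : ℂ)) a s ξ =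
      (Complex.exp (((-a * jap ‖ξ‖ : ℝ) : ℂ) * Complex.I) *
        ((-‖ξ‖ ^ 2 / jap ‖ξ‖ : ℝ) : ℂ)) * w s := by
    intro s
    have : -Complex.I * ((a - s : ℝ) : ℂ) * ((jap ‖ξ‖ : ℝ) : ℂ) =
        ((-a * jap ‖ξ‖ : ℝ) : ℂ) * Complex.I +
          Complex.I * (s : ℂ) * ((jap ‖ξ‖ : ℝ) : ℂ) := by
      push_cast; ring
    simp only [duhamelSymbol, this, Complex.exp_add, w]
    ring
  simp_rw [hfac]
  rw [intervalIntegral.integral_const_mul, norm_mul, norm_mul, Complex.norm_exp_ofReal_mul_I,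
    one_mul, Complex.norm_real, Real.norm_eq_abs, neg_div, abs_neg,
    abs_of_nonneg (div_nonneg (sq_nonneg _) (jap_pos _).le)]
  refine mul_le_mul_of_nonneg_left ?_ (div_nonneg (sq_nonneg _) (jap_pos _).le)
  have hre : (∫ s in (0 : ℝ)..a, w s).re = ∫ s in (0 : ℝ)..a, (w s).re :=
    (Complex.reCLM.intervalIntegral_comp_comm (hw.intervalIntegrable _ _)).symm
  calc a * ((∫ η, g (ξ + η) * g η) / 2)
      = ∫ _ in (0 : ℝ)..a, (∫ η, g (ξ + η) * g η) / 2 := by simp [mul_div_assoc]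
    _ ≤ ∫ s in (0 : ℝ)..a, (w s).re :=
        intervalIntegral.integral_mono_on ha₀ (by simp)
          ((Complex.continuous_re.comp hw).intervalIntegrable _ _)
          fun s h => half_autocorr_le_re hc hs hg h.1 (h.2.trans ha₁) hΩ
    _ ≤ ‖∫ s in (0 : ℝ)..a, w s‖ := hre ▸ Complex.re_le_norm _

lemma measureReal_le_autocorr (hc : HasCompactSupport g) (hs : ContDiff ℝ ∞ g) {ξ : Plane} {B : Set Plane} (hg : ∀ η, 0 ≤ g η)
    (hB : MeasurableSet B) (hB' : volume B ≠ ⊤) (h₁ : ∀ η ∈ B, 1 ≤ g (ξ + η))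
    (h₂ : ∀ η ∈ B, 1 ≤ g η) : volume.real B ≤ ∫ η, g (ξ + η) * g η := by
  rw [← integral_indicator_one hB]
  refine integral_mono ((integrable_indicator_iff hB).2 (integrableOn_const hB'))
    (integrable_autocorr hc hs ξ) fun η => ?_
  by_cases hη : η ∈ B
  · simpa [hη] using one_le_mul_of_one_le_of_one_le (h₁ η hη) (h₂ η hη)
  · simpa [hη] using mul_nonneg (hg (ξ + η)) (hg η)

end LowerBound

section Construction

/-- The cutoff equal to `1` on `[-1/32, 1/32]` and supported in `[-1/16, 1/16]`. -/
def cutoff : ContDiffBump (0 : ℝ) := ⟨1 / 32, 1 / 16, by norm_num, by norm_num⟩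

lemma cutoff_eq_one {x : ℝ} (hx : |x| ≤ 1 / 32) : cutoff x = 1 :=
  cutoff.one_of_mem_closedBall (by simpa [cutoff] using hx)

lemma abs_le_of_cutoff_ne_zero {x : ℝ} (hx : cutoff x ≠ 0) : |x| ≤ 1 / 16 := by
  by_contra! h
  exact hx (cutoff.zero_of_le_dist (by simpa [cutoff] using h.le))

/-- Two bumps adapted to thin boxes at distance about `N`, whose interaction is resonant. -/
def resonantPair (N : ℝ) (ξ : Plane) : ℝ :=
  (cutoff (N * (ξ 0 - (N / 2 + 1 / 2))) + cutoff (N * (ξ 0 - (-N / 2 + 1 / 2)))) * cutoff (ξ 1)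

lemma contDiff_resonantPair (N : ℝ) : ContDiff ℝ ∞ (resonantPair N) := by
  have h : ∀ i, ContDiff ℝ ∞ fun ξ : Plane => ξ i := fun i => contDiff_piLp_apply 2
  have h' : ∀ c, ContDiff ℝ ∞ fun ξ : Plane => cutoff (N * (ξ 0 - c)) := fun c =>
    cutoff.contDiff.comp (contDiff_const.mul ((h 0).sub contDiff_const))
  exact ((h' _).add (h' _)).mul (cutoff.contDiff.comp (h 1))

lemma contDiff_ofReal_resonantPair (N : ℝ) :
    ContDiff ℝ ∞ fun ξ => (resonantPair N ξ : ℂ) :=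
  Complex.ofRealCLM.contDiff.comp (contDiff_resonantPair N)

lemma resonantPair_nonneg (N : ℝ) (ξ : Plane) : 0 ≤ resonantPair N ξ :=
  mul_nonneg (add_nonneg cutoff.nonneg cutoff.nonneg) cutoff.nonneg

lemma resonantPair_le_two (N : ℝ) (ξ : Plane) : resonantPair N ξ ≤ 2 := by
  have h₁ := cutoff.le_one (x := N * (ξ 0 - (N / 2 + 1 / 2)))
  have h₂ := cutoff.le_one (x := N * (ξ 0 - (-N / 2 + 1 / 2)))
  have h₃ := cutoff.le_one (x := ξ 1)
  exact (mul_le_mul (add_le_add h₁ h₂) h₃ cutoff.nonneg (by norm_num)).trans (by norm_num)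

variable {N : ℝ}

lemma abs_mul_le_iff {x r : ℝ} (hN : 0 < N) : |N * x| ≤ r ↔ |x| ≤ r / N := by
  rw [abs_mul, abs_of_pos hN, le_div_iff₀ hN, mul_comm]

lemma mem_thinBox_of_resonantPair_ne_zero (hN : 0 < N) {ξ : Plane}
    (h : resonantPair N ξ ≠ 0) :
    ξ ∈ thinBox N (N / 2 + 1 / 2) (1 / 16) ∪ thinBox N (-N / 2 + 1 / 2) (1 / 16) := by
  have h₁ := abs_le_of_cutoff_ne_zero (right_ne_zero_of_mul h)
  by_cases h₂ : cutoff (N * (ξ 0 - (N / 2 + 1 / 2))) = 0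
  · have h₃ : cutoff (N * (ξ 0 - (-N / 2 + 1 / 2))) ≠ 0 := fun h₃ =>
      left_ne_zero_of_mul h (by rw [h₂, h₃, add_zero])
    exact Or.inr ⟨(abs_mul_le_iff hN).1 (abs_le_of_cutoff_ne_zero h₃), h₁⟩
  · exact Or.inl ⟨(abs_mul_le_iff hN).1 (abs_le_of_cutoff_ne_zero h₂), h₁⟩

lemma hasCompactSupport_resonantPair (hN : 0 < N) : HasCompactSupport (resonantPair N) :=
  .intro ((isCompact_thinBox N _ _).union (isCompact_thinBox N _ _)) fun _ hξ =>
    not_not.1 fun h => hξ (mem_thinBox_of_resonantPair_ne_zero hN h)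

lemma hasCompactSupport_ofReal_resonantPair (hN : 0 < N) :
    HasCompactSupport fun ξ => (resonantPair N ξ : ℂ) :=
  (hasCompactSupport_resonantPair hN).comp_left Complex.ofReal_zero

lemma one_le_resonantPair_left (hN : 0 < N) {ξ : Plane}
    (h : ξ ∈ thinBox N (N / 2 + 1 / 2) (1 / 32)) : 1 ≤ resonantPair N ξ := by
  rw [resonantPair, cutoff_eq_one ((abs_mul_le_iff hN).2 h.1), cutoff_eq_one h.2, mul_one]
  linarith [cutoff.nonneg (x := N * (ξ 0 - (-N / 2 + 1 / 2)))]

lemma one_le_resonantPair_right (hN : 0 < N) {ξ : Plane}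
    (h : ξ ∈ thinBox N (-N / 2 + 1 / 2) (1 / 32)) : 1 ≤ resonantPair N ξ := by
  rw [resonantPair, cutoff_eq_one ((abs_mul_le_iff hN).2 h.1), cutoff_eq_one h.2, mul_one]
  linarith [cutoff.nonneg (x := N * (ξ 0 - (N / 2 + 1 / 2)))]

lemma thinBox_mono (hN : 0 < N) (c : ℝ) {r r' : ℝ} (h : r ≤ r') :
    thinBox N c r ⊆ thinBox N c r' := fun _ hξ =>
  ⟨hξ.1.trans (by gcongr), hξ.2.trans h⟩

lemma add_mem_thinBox {c c' r r' : ℝ} {ξ η : Plane} (hξ : ξ ∈ thinBox N c r)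
    (hη : η ∈ thinBox N c' r') : ξ + η ∈ thinBox N (c + c') (r + r') := by
  refine ⟨?_, (abs_add_le _ _).trans (add_le_add hξ.2 hη.2)⟩
  have := (abs_add_le (ξ 0 - c) (η 0 - c')).trans (add_le_add hξ.1 hη.1)
  rw [add_div]
  convert! this using 2
  simp only [PiLp.add_apply]; ring

lemma resonance_of_resonantPair (hN : 10 ≤ N) {ξ η : Plane} (hξ : ξ ∈ thinBox N N (1 / 64))
    (h : resonantPair N (ξ + η) * resonantPair N η ≠ 0) :
    |jap ‖ξ‖ - (‖ξ + η‖ ^ 2 - ‖η‖ ^ 2)| ≤ 1 := by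
  have hN0 : 0 < N := by linarith
  have hμ : 1 / 16 / N ≤ 1 / 160 := by rw [div_le_iff₀ hN0]; linarith
  have hμ' : 1 / 64 / N ≤ 1 / 160 := by rw [div_le_iff₀ hN0]; linarith
  have hξ0 := abs_le.1 (hξ.1.trans hμ')
  have hsum : (ξ + η) 0 = ξ 0 + η 0 := rfl
  have hsum' : (ξ + η) 1 = ξ 1 + η 1 := rfl
  rcases mem_thinBox_of_resonantPair_ne_zero hN0 (left_ne_zero_of_mul h) with hx | hx <;>
  rcases mem_thinBox_of_resonantPair_ne_zero hN0 (right_ne_zero_of_mul h) with hy | hy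
  · have h₁ := abs_le.1 (hx.1.trans hμ)
    have h₂ := abs_le.1 (hy.1.trans hμ)
    rw [hsum] at h₁
    linarith
  · rw [jap, norm_sq_plane, norm_sq_plane, norm_sq_plane, hsum, hsum']
    have h₁ := hx.1
    have h₃ := hx.2
    rw [hsum] at h₁
    rw [hsum'] at h₃
    exact abs_resonance_le_one hN h₁ hy.1 h₃ hy.2
  · have h₁ := abs_le.1 (hx.1.trans hμ)
    have h₂ := abs_le.1 (hy.1.trans hμ)
    rw [hsum] at h₁
    linarith
  · have h₁ := abs_le.1 (hx.1.trans hμ)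
    have h₂ := abs_le.1 (hy.1.trans hμ)
    rw [hsum] at h₁
    linarith

lemma eLpNorm_two_indicator {S : Set Plane} (hS : MeasurableSet S) {C v : ℝ} (hC : 0 ≤ C)
    (hv : 0 ≤ v) (hvol : volume S = ENNReal.ofReal v) :
    eLpNorm (S.indicator fun _ => C) 2 volume = ENNReal.ofReal (C * √v) := by
  rw [eLpNorm_indicator_const hS (by norm_num) (by norm_num), hvol, ENNReal.toReal_ofNat,
    ENNReal.ofReal_rpow_of_nonneg hv (by norm_num), ← Real.sqrt_eq_rpow,
    Real.enorm_eq_ofReal hC, ← ENNReal.ofReal_mul hC]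

lemma Hnorm_fourierInv_resonantPair_le (hN : 10 ≤ N) (k : ℝ) :
    Hnorm k (𝓕⁻ fun ξ => (resonantPair N ξ : ℂ)) ≤
      ENNReal.ofReal (2 * (4 ^ |k| * N ^ k) * √(1 / (32 * N))) := by
  have hN0 : 0 < N := by linarith
  have hμ : 1 / 16 / N ≤ 1 / 160 := by rw [div_le_iff₀ hN0]; linarith
  let A := thinBox N (N / 2 + 1 / 2) (1 / 16)
  let B := thinBox N (-N / 2 + 1 / 2) (1 / 16)
  have hdisj : Disjoint A B := by
    rw [Set.disjoint_left]
    intro ξ hA hB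
    linarith [abs_le.1 (hA.1.trans hμ), abs_le.1 (hB.1.trans hμ)]
  have hvol : volume (A ∪ B) = ENNReal.ofReal (1 / (32 * N)) := by
    rw [measure_union hdisj (isClosed_thinBox _ _ _).measurableSet,
      volume_thinBox _ hN0 (by norm_num), volume_thinBox _ hN0 (by norm_num),
      ← ENNReal.ofReal_add (by positivity) (by positivity)]
    congr 1; field_simp; norm_num
  have hAB : MeasurableSet (A ∪ B) :=
    (isClosed_thinBox _ _ _).measurableSet.union (isClosed_thinBox _ _ _).measurableSet
  rw [← eLpNorm_two_indicator hAB (by positivity) (by positivity) hvol, Hnorm,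
    fourier_fourierInv_of_hasCompactSupport
      (hasCompactSupport_ofReal_resonantPair hN0) (contDiff_ofReal_resonantPair N)]
  refine eLpNorm_mono_real fun ξ => ?_
  rw [norm_mul, Complex.norm_real, Complex.norm_real,
    Real.norm_of_nonneg (rpow_nonneg (jap_pos _).le _),
    Real.norm_of_nonneg (resonantPair_nonneg _ _)]
  by_cases hξ : ξ ∈ A ∪ B
  · rw [indicator_of_mem hξ, mul_comm]
    have hj : N / 4 ≤ jap ‖ξ‖ ∧ jap ‖ξ‖ ≤ 4 * N := by
      rcases hξ with hξ | hξ
      · have h₀ := abs_le.1 (hξ.1.trans hμ)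
        have h₁ : ξ 0 ≤ |ξ 0| := le_abs_self _
        refine jap_mem_Icc hN (by linarith) (abs_le.2 ?_) (hξ.2.trans (by norm_num))
        constructor <;> linarith
      · have h₀ := abs_le.1 (hξ.1.trans hμ)
        have h₁ : -ξ 0 ≤ |ξ 0| := neg_le_abs _
        refine jap_mem_Icc hN (by linarith) (abs_le.2 ?_) (hξ.2.trans (by norm_num))
        constructor <;> linarith
    exact mul_le_mul (resonantPair_le_two _ _) (rpow_le_of_mem_Icc hN0 hj.1 hj.2 k)
      (rpow_nonneg (jap_pos _).le _) (by norm_num)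
  · have : resonantPair N ξ = 0 :=
      not_not.1 fun h => hξ (mem_thinBox_of_resonantPair_ne_zero hN0 h)
    rw [indicator_of_notMem hξ, this, mul_zero]

lemma le_Hnorm_duhamel_resonantPair (hN : 10 ≤ N) {T : ℝ} (hT0 : 0 ≤ T) (hT1 : T ≤ 1) (ℓ : ℝ) :
    ENNReal.ofReal ((4 ^ |ℓ|)⁻¹ * N ^ ℓ * (N / 4 * (T * (1 / (1024 * N) / 2))) *
        √(1 / (1024 * N))) ≤
      Hnorm ℓ (fun x => ∫ s in (0 : ℝ)..T, waveG (T - s)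
        (DeltaOp fun y => schrG s (𝓕⁻ fun ξ => (resonantPair N ξ : ℂ)) y *
          conj (schrG s (𝓕⁻ fun ξ => (resonantPair N ξ : ℂ)) y)) x) := by
  have hN0 : 0 < N := by linarith
  have hμ : 1 / 64 / N ≤ 1 / 160 := by rw [div_le_iff₀ hN0]; linarith
  have hc := hasCompactSupport_resonantPair hN0
  have hs := contDiff_resonantPair N
  have hvol : ∀ c, volume (thinBox N c (1 / 64)) = ENNReal.ofReal (1 / (1024 * N)) := fun c => by
    rw [volume_thinBox _ hN0 (by norm_num)]
    congr 1; field_simp; norm_num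
  rw [← eLpNorm_two_indicator (isClosed_thinBox _ _ _).measurableSet (by positivity)
    (by positivity) (hvol N), Hnorm,
    fourier_duhamel (hasCompactSupport_ofReal_resonantPair hN0)
      (contDiff_ofReal_resonantPair N) hT0]
  refine eLpNorm_mono fun ξ => ?_
  by_cases hξ : ξ ∈ thinBox N N (1 / 64)
  · rw [indicator_of_mem hξ, Real.norm_of_nonneg (by positivity), norm_mul, Complex.norm_real,
      Real.norm_of_nonneg (rpow_nonneg (jap_pos _).le _)]
    have h₀ := abs_le.1 (hξ.1.trans hμ)
    have h₁ : ξ 0 ≤ |ξ 0| := le_abs_self _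
    have hj := jap_mem_Icc hN (ξ := ξ) (by linarith)
      (abs_le.2 (by constructor <;> linarith)) (hξ.2.trans (by norm_num))
    have hB : 1 / (1024 * N) ≤ ∫ η, resonantPair N (ξ + η) * resonantPair N η := by
      have hreal : volume.real (thinBox N (-N / 2 + 1 / 2) (1 / 64)) = 1 / (1024 * N) := by
        rw [Measure.real, hvol, ENNReal.toReal_ofReal (by positivity)]
      rw [← hreal]
      refine measureReal_le_autocorr hc hs (resonantPair_nonneg N)
        (isClosed_thinBox _ _ _).measurableSet (by rw [hvol]; exact ENNReal.ofReal_ne_top)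
        (fun η hη => one_le_resonantPair_left hN0 ?_)
        fun η hη => one_le_resonantPair_right hN0 (thinBox_mono hN0 _ (by norm_num) hη)
      convert! add_mem_thinBox hξ hη using 1
      congr 1 <;> ring
    refine mul_le_mul (le_rpow_of_mem_Icc hN0 hj.1 hj.2 ℓ) (le_trans ?_
      (le_norm_integral_duhamelSymbol hc hs (resonantPair_nonneg N) hT0 hT1
        fun η h => resonance_of_resonantPair hN hξ h)) (by positivity)
      (rpow_nonneg (jap_pos _).le _)
    have hm := le_norm_sq_div_jap hN (ξ := ξ) (by linarith)
    have hm0 : 0 ≤ ‖ξ‖ ^ 2 / jap ‖ξ‖ := le_trans (by positivity) hm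
    gcongr
  · rw [indicator_of_notMem hξ, norm_zero]
    exact norm_nonneg _

lemma fourierInv_resonantPair_ne_zero (hN : 0 < N) :
    (𝓕⁻ fun ξ => (resonantPair N ξ : ℂ)) ≠ 0 := by
  intro h
  have h₁ := fourier_fourierInv_of_hasCompactSupport
    (hasCompactSupport_ofReal_resonantPair hN) (contDiff_ofReal_resonantPair N)
  have h₂ := congrFun h₁ !₂[N / 2 + 1 / 2, 0]
  have h₃ : 1 ≤ resonantPair N !₂[N / 2 + 1 / 2, 0] := one_le_resonantPair_left hN (by
    constructor
    · simp; positivity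
    · simp)
  have h₄ : 𝓕 (𝓕⁻ fun ξ => (resonantPair N ξ : ℂ)) !₂[N / 2 + 1 / 2, 0] = 0 := by
    rw [h, fourier_eq']; simp
  have h₅ : (resonantPair N !₂[N / 2 + 1 / 2, 0] : ℂ) = 0 := h₂.symm.trans h₄
  rw [Complex.ofReal_eq_zero.1 h₅] at h₃
  linarith

end Construction

end Iterate

/-- Unboundedness of the second-order Duhamel iterate, wave component. -/
theorem unbounded_second_iterate_wave (T k ℓ : ℝ) (hT0 : 0 < T) (hT1 : T ≤ 1) :
    ∃ c N₀ : ℝ, 0 < c ∧ 1 ≤ N₀ ∧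
      ∀ N : ℝ, N₀ ≤ N →
        ∃ u : Plane → ℂ, u ≠ 0 ∧ Hnorm k u < ⊤ ∧
          ENNReal.ofReal (c * N ^ (ℓ - 2 * k + 1 / 2)) * Hnorm k u * Hnorm k u ≤
            ⨆ t ∈ Set.Icc (-T) T,
              Hnorm ℓ (fun x => ∫ t' in (0 : ℝ)..t,
                waveG (t - t')
                  (DeltaOp fun y => schrG t' u y * (starRingEnd ℂ) (schrG t' u y)) x) := by
  refine ⟨(4 ^ |ℓ|)⁻¹ * T / 32768 / (4 ^ |k|) ^ 2, 10, by positivity, by norm_num,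
    fun N hN => ?_⟩
  have hN0 : 0 < N := by linarith
  have hup := Hnorm_fourierInv_resonantPair_le hN k
  refine ⟨𝓕⁻ fun ξ => (resonantPair N ξ : ℂ), fourierInv_resonantPair_ne_zero hN0,
    hup.trans_lt ENNReal.ofReal_lt_top, ?_⟩
  refine le_trans ?_ ((le_Hnorm_duhamel_resonantPair hN hT0.le hT1 ℓ).trans
    (le_iSup₂_of_le T ⟨by linarith, le_rfl⟩ le_rfl))
  refine (mul_le_mul' (mul_le_mul' le_rfl hup) hup).trans ?_
  rw [← ENNReal.ofReal_mul (by positivity), ← ENNReal.ofReal_mul (by positivity)]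
  refine ENNReal.ofReal_le_ofReal (le_of_eq ?_)
  have hU : √(1 / (32 * N)) * √(1 / (32 * N)) = 1 / (32 * N) :=
    Real.mul_self_sqrt (by positivity)
  have hD : √(1 / (1024 * N)) = 1 / (32 * √N) := by
    rw [Real.sqrt_div zero_le_one, Real.sqrt_mul (by norm_num), Real.sqrt_one,
      (by norm_num : (1024 : ℝ) = 32 ^ 2), Real.sqrt_sq (by norm_num)]
  have hpow : N ^ (ℓ - 2 * k + 1 / 2) = N ^ ℓ / (N ^ k) ^ 2 * √N := by
    rw [rpow_add hN0, rpow_sub hN0, ← Real.sqrt_eq_rpow, mul_comm 2 k, rpow_mul hN0.le,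
      rpow_two]
  have hk : N ^ k ≠ 0 := (rpow_pos_of_pos hN0 k).ne'
  have hr : √N ≠ 0 := (Real.sqrt_pos.2 hN0).ne'
  have hr2 : √N ^ 2 = N := Real.sq_sqrt hN0.le
  calc _ = (4 ^ |ℓ|)⁻¹ * T / 32768 / (4 ^ |k|) ^ 2 * N ^ (ℓ - 2 * k + 1 / 2) *
        (2 * (4 ^ |k| * N ^ k)) ^ 2 * (√(1 / (32 * N)) * √(1 / (32 * N))) := by ring
    _ = _ := by
      rw [hU, hD, hpow]
      field_simp
      rw [hr2]
      ring
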